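/- arXiv:1606.08675 — 5 statements merged into one kernel-verified Lean document; each statement's English description precedes it below -/
import Mathlib

section
/- Let sp(3,ℝ) = {X ∈ M₆(ℝ) : XᵀJ + JX = 0}, J = [[0,I₃],[−I₃,0]], whose general element is X = [[A,B],[C,−Aᵀ]] with A = [[c₁₁,c₁₂,q₁],[c₂₁,c₂₂,q₂],[−p₁,−p₂,c]], B = [[b₁₁,b₁₂,v₁],[b₁₂,b₂₂,v₂],[v₁,v₂,q]] symmetric, C = [[a₁₁,a₁₂,u₁],[a₁₂,a₂₂,u₂],[u₁,u₂,p]] symmetric. Define the subspaces: g₋₃ = {X : only the entries a₁₁,a₁₂,a₂₂ may be nonzero}, g₋₂ = {X : only u₁,u₂ may be nonzero}, g₋₁ = {X : only p₁,p₂,p may be nonzero}, g₀ = {X : only c₁₁,c₁₂,c₂₁,c₂₂,c may be nonzero}, g₁ = {X : only q₁,q₂,q may be nonzero}, g₂ = {X : only v₁,v₂ may be nonzero}, g₃ = {X : only b₁₁,b₁₂,b₂₂ may be nonzero}. Then sp(3,ℝ) is the internal direct sum g₋₃ ⊕ g₋₂ ⊕ g₋₁ ⊕ g₀ ⊕ g₁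 ⊕ g₂ ⊕ g₃, the dimensions are dim g₋₃ = dim g₋₁ = dim g₁ = dim g₃ = 3, dim g₋₂ = dim g₂ = 2, dim g₀ = 5, and the commutator satisfies [gᵢ, gⱼ] ⊆ g_{i+j}, where g_k = {0} whenever |k| > 3 (the Monge gradation of sp(3,ℝ)). -/
open Matrix

noncomputable section

/-- Assemble a 6×6 matrix from four 3×3 blocks. -/
def blk6 (A B C D : Matrix (Fin 3) (Fin 3) ℝ) : Matrix (Fin 6) (Fin 6) ℝ :=
  Matrix.reindex finSumFinEquiv finSumFinEquiv (Matrix.fromBlocks A B C D)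

/-- The standard symplectic matrix `J = [[0, I₃], [−I₃, 0]]`. -/
def J6 : Matrix (Fin 6) (Fin 6) ℝ := blk6 0 1 (-1) 0

/-- `sp(3,ℝ) = {X : Xᵀ J + J X = 0}` as a real subspace of the 6×6 matrices. -/
def sp3 : Submodule ℝ (Matrix (Fin 6) (Fin 6) ℝ) where
  carrier := {X | Xᵀ * J6 + J6 * X = 0}
  add_mem' := by
    intro a b ha hb
    simp only [Set.mem_setOf_eq] at ha hb ⊢
    rw [Matrix.transpose_add, Matrix.add_mul, Matrix.mul_add,
      show aᵀ * J6 + bᵀ * J6 + (J6 * a + J6 * b)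
          = aᵀ * J6 + J6 * a + (bᵀ * J6 + J6 * b) from by abel,
      ha, hb, add_zero]
  zero_mem' := by
    simp
  smul_mem' := by
    intro c a ha
    simp only [Set.mem_setOf_eq] at ha ⊢
    rw [Matrix.transpose_smul, Matrix.smul_mul, Matrix.mul_smul, ← smul_add, ha, smul_zero]

/-- The general element of `sp(3,ℝ)`: `X = [[A,B],[C,−Aᵀ]]` with
`A = [[c₁₁,c₁₂,q₁],[c₂₁,c₂₂,q₂],[−p₁,−p₂,c]]`,
`B = [[b₁₁,b₁₂,v₁],[b₁₂,b₂₂,v₂],[v₁,v₂,q]]` symmetric,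
`C = [[a₁₁,a₁₂,u₁],[a₁₂,a₂₂,u₂],[u₁,u₂,p]]` symmetric. -/
def spElt (a11 a12 a22 u1 u2 p1 p2 p c11 c12 c21 c22 c q1 q2 q v1 v2 b11 b12 b22 : ℝ) :
    Matrix (Fin 6) (Fin 6) ℝ :=
  blk6 !![c11, c12, q1; c21, c22, q2; -p1, -p2, c]
       !![b11, b12, v1; b12, b22, v2; v1, v2, q]
       !![a11, a12, u1; a12, a22, u2; u1, u2, p]
       (-(!![c11, c12, q1; c21, c22, q2; -p1, -p2, c]ᵀ))

/-- The Monge gradation `g_k` of `sp(3,ℝ)`, with `g_k = {0}` for `|k| > 3`. -/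
def gMonge : ℤ → Submodule ℝ (Matrix (Fin 6) (Fin 6) ℝ) := fun k =>
  if k = -3 then
    Submodule.span ℝ {X | ∃ a11 a12 a22 : ℝ,
      X = spElt a11 a12 a22 0 0 0 0 0 0 0 0 0 0 0 0 0 0 0 0 0 0}
  else if k = -2 then
    Submodule.span ℝ {X | ∃ u1 u2 : ℝ,
      X = spElt 0 0 0 u1 u2 0 0 0 0 0 0 0 0 0 0 0 0 0 0 0 0}
  else if k = -1 then
    Submodule.span ℝ {X | ∃ p1 p2 p : ℝ,
      X = spElt 0 0 0 0 0 p1 p2 p 0 0 0 0 0 0 0 0 0 0 0 0 0}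
  else if k = 0 then
    Submodule.span ℝ {X | ∃ c11 c12 c21 c22 c : ℝ,
      X = spElt 0 0 0 0 0 0 0 0 c11 c12 c21 c22 c 0 0 0 0 0 0 0 0}
  else if k = 1 then
    Submodule.span ℝ {X | ∃ q1 q2 q : ℝ,
      X = spElt 0 0 0 0 0 0 0 0 0 0 0 0 0 q1 q2 q 0 0 0 0 0}
  else if k = 2 then
    Submodule.span ℝ {X | ∃ v1 v2 : ℝ,
      X = spElt 0 0 0 0 0 0 0 0 0 0 0 0 0 0 0 0 v1 v2 0 0 0}
  else if k = 3 then
    Submodule.span ℝ {X | ∃ b11 b12 b22 : ℝ,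
      X = spElt 0 0 0 0 0 0 0 0 0 0 0 0 0 0 0 0 0 0 b11 b12 b22}
  else ⊥


/-- Explicit 6×6 form of the general element. -/
lemma spElt_eq (a11 a12 a22 u1 u2 p1 p2 p c11 c12 c21 c22 c q1 q2 q v1 v2 b11 b12 b22 : ℝ) :
    spElt a11 a12 a22 u1 u2 p1 p2 p c11 c12 c21 c22 c q1 q2 q v1 v2 b11 b12 b22 =
    !![c11, c12, q1, b11, b12, v1;
       c21, c22, q2, b12, b22, v2;
       -p1, -p2, c, v1, v2, q;
       a11, a12, u1, -c11, -c21, p1;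
       a12, a22, u2, -c12, -c22, p2;
       u1, u2, p, -q1, -q2, -c] := by
  ext i j
  fin_cases i <;> fin_cases j <;> first | rfl | exact (neg_neg _).symm | exact neg_neg _

lemma J6_eq : J6 =
    !![0, 0, 0, 1, 0, 0;
       0, 0, 0, 0, 1, 0;
       0, 0, 0, 0, 0, 1;
       -1, 0, 0, 0, 0, 0;
       0, -1, 0, 0, 0, 0;
       0, 0, -1, 0, 0, 0] := by
  ext i j
  fin_cases i <;> fin_cases j <;> simp [J6, blk6, finSumFinEquiv, Fin.addCases]

lemma mem_sp3 (X : Matrix (Fin 6) (Fin 6) ℝ) : X ∈ sp3 ↔ Xᵀ * J6 + J6 * X = 0 := Iff.rfl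

lemma spElt_mem (a11 a12 a22 u1 u2 p1 p2 p c11 c12 c21 c22 c q1 q2 q v1 v2 b11 b12 b22 : ℝ) :
    spElt a11 a12 a22 u1 u2 p1 p2 p c11 c12 c21 c22 c q1 q2 q v1 v2 b11 b12 b22 ∈ sp3 := by
  rw [mem_sp3, J6_eq, spElt_eq]
  ext i j
  fin_cases i <;> fin_cases j <;> simp [Matrix.mul_apply, Fin.sum_univ_succ]

lemma eq_spElt_of_mem {X : Matrix (Fin 6) (Fin 6) ℝ} (h : X ∈ sp3) :
    X = spElt (X 3 0) (X 3 1) (X 4 1) (X 3 2) (X 4 2) (-X 2 0) (-X 2 1) (X 5 2)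
      (X 0 0) (X 0 1) (X 1 0) (X 1 1) (X 2 2) (X 0 2) (X 1 2) (X 2 5) (X 0 5) (X 1 5)
      (X 0 3) (X 0 4) (X 1 4) := by
  rw [mem_sp3, J6_eq] at h
  have H : ∀ i j, _ := fun i j => congrFun (congrFun h i) j
  simp only [Matrix.add_apply, Matrix.mul_apply, Fin.sum_univ_six] at H
  clear h
  rw [spElt_eq]
  ext i j
  have h00 := H 0 0
  have h01 := H 0 1
  have h02 := H 0 2
  have h03 := H 0 3
  have h04 := H 0 4
  have h05 := H 0 5
  have h12 := H 1 2
  have h13 := H 1 3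
  have h14 := H 1 4
  have h15 := H 1 5
  have h23 := H 2 3
  have h24 := H 2 4
  have h25 := H 2 5
  have h34 := H 3 4
  have h35 := H 3 5
  have h45 := H 4 5
  clear H
  simp at h00 h01 h02 h03 h04 h05 h12 h13 h14 h15 h23 h24 h25 h34 h35 h45
  fin_cases i <;> fin_cases j <;> simp <;> linarith

/-- Weights of (twice) the grading element. -/
def wt : Fin 6 → ℝ := ![3, 3, 1, -3, -3, -1]

/-- Twice the grading element. -/
def gradE : Matrix (Fin 6) (Fin 6) ℝ := Matrix.diagonal wt

/-- `ad` of the grading element. -/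
def adE : Module.End ℝ (Matrix (Fin 6) (Fin 6) ℝ) :=
  LinearMap.mulLeft ℝ gradE - LinearMap.mulRight ℝ gradE

lemma adE_apply (X : Matrix (Fin 6) (Fin 6) ℝ) : adE X = gradE * X - X * gradE := rfl

/-- The homogeneous parts as eigenspaces. -/
def gEig (k : ℤ) : Submodule ℝ (Matrix (Fin 6) (Fin 6) ℝ) :=
  sp3 ⊓ Module.End.eigenspace adE (2 * (k : ℝ))

lemma mem_gEig {k : ℤ} {X : Matrix (Fin 6) (Fin 6) ℝ} :
    X ∈ gEig k ↔ X ∈ sp3 ∧ gradE * X - X * gradE = (2 * (k : ℝ)) • X := by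
  rw [gEig, Submodule.mem_inf, Module.End.mem_eigenspace_iff, adE_apply]

lemma mem_gEig_entry {k : ℤ} {X : Matrix (Fin 6) (Fin 6) ℝ} :
    X ∈ gEig k ↔ X ∈ sp3 ∧ ∀ i j, (wt i - wt j) * X i j = 2 * (k : ℝ) * X i j := by
  rw [mem_gEig, ← Matrix.ext_iff]
  refine and_congr_right fun _ => forall_congr' fun i => forall_congr' fun j => ?_
  simp only [gradE, Matrix.sub_apply, Matrix.diagonal_mul, Matrix.mul_diagonal,
    Matrix.smul_apply, smul_eq_mul]
  rw [sub_mul, mul_comm (X i j)]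

lemma gEig_zero {k : ℤ} {X : Matrix (Fin 6) (Fin 6) ℝ} (h : X ∈ gEig k) (i j : Fin 6)
    (d : ℤ) (hd : wt i - wt j = 2 * (d : ℝ)) (hk : k ≠ d) : X i j = 0 := by
  have := (mem_gEig_entry.1 h).2 i j
  rw [hd] at this
  have h2 : ((d : ℝ) - k) ≠ 0 := sub_ne_zero.2 (by exact_mod_cast hk.symm)
  have h3 : ((d : ℝ) - k) * X i j = 0 := by linarith
  exact (mul_eq_zero.1 h3).resolve_left h2

lemma gEig_entries {k : ℤ} {X : Matrix (Fin 6) (Fin 6) ℝ} (h : X ∈ gEig k) :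
    (k ≠ -3 → X 3 0 = 0 ∧ X 3 1 = 0 ∧ X 4 1 = 0) ∧
    (k ≠ -2 → X 3 2 = 0 ∧ X 4 2 = 0) ∧
    (k ≠ -1 → X 2 0 = 0 ∧ X 2 1 = 0 ∧ X 5 2 = 0) ∧
    (k ≠ 0 → X 0 0 = 0 ∧ X 0 1 = 0 ∧ X 1 0 = 0 ∧ X 1 1 = 0 ∧ X 2 2 = 0) ∧
    (k ≠ 1 → X 0 2 = 0 ∧ X 1 2 = 0 ∧ X 2 5 = 0) ∧
    (k ≠ 2 → X 0 5 = 0 ∧ X 1 5 = 0) ∧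
    (k ≠ 3 → X 0 3 = 0 ∧ X 0 4 = 0 ∧ X 1 4 = 0) := by
  refine ⟨fun hk => ?_, fun hk => ?_, fun hk => ?_, fun hk => ?_, fun hk => ?_, fun hk => ?_,
    fun hk => ?_⟩ <;> and_intros <;>
    refine gEig_zero h _ _ _ ?_ hk <;> simp [wt] <;> norm_num

lemma spElt_add (a11 a12 a22 u1 u2 p1 p2 p c11 c12 c21 c22 c q1 q2 q v1 v2 b11 b12 b22
    a11_r a12_r a22_r u1_r u2_r p1_r p2_r p_r c11_r c12_r c21_r c22_r c_r q1_r q2_r q_r v1_r v2_r b11_r b12_r b22_r : ℝ) :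
    spElt a11 a12 a22 u1 u2 p1 p2 p c11 c12 c21 c22 c q1 q2 q v1 v2 b11 b12 b22 +
    spElt a11_r a12_r a22_r u1_r u2_r p1_r p2_r p_r c11_r c12_r c21_r c22_r c_r q1_r q2_r q_r v1_r v2_r b11_r b12_r b22_r =
    spElt (a11 + a11_r) (a12 + a12_r) (a22 + a22_r) (u1 + u1_r) (u2 + u2_r) (p1 + p1_r) (p2 + p2_r) (p + p_r) (c11 + c11_r) (c12 + c12_r) (c21 + c21_r) (c22 + c22_r) (c + c_r) (q1 + q1_r) (q2 + q2_r) (q + q_r) (v1 + v1_r) (v2 + v2_r) (b11 + b11_r) (b12 + b12_r) (b22 + b22_r) := by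
  simp only [spElt_eq]
  ext i j
  fin_cases i <;> fin_cases j <;> simp [add_comm]

lemma spElt_smul (r a11 a12 a22 u1 u2 p1 p2 p c11 c12 c21 c22 c q1 q2 q v1 v2 b11 b12 b22 : ℝ) :
    r • spElt a11 a12 a22 u1 u2 p1 p2 p c11 c12 c21 c22 c q1 q2 q v1 v2 b11 b12 b22 =
    spElt (r * a11) (r * a12) (r * a22) (r * u1) (r * u2) (r * p1) (r * p2) (r * p) (r * c11) (r * c12) (r * c21) (r * c22) (r * c) (r * q1) (r * q2) (r * q) (r * v1) (r * v2) (r * b11) (r * b12) (r * b22) := by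
  simp only [spElt_eq]
  ext i j
  fin_cases i <;> fin_cases j <;> simp

lemma spElt_mem_m3 (a11 a12 a22 : ℝ) :
    spElt a11 a12 a22 0 0 0 0 0 0 0 0 0 0 0 0 0 0 0 0 0 0 ∈ gEig (-3) := by
  refine mem_gEig_entry.2 ⟨spElt_mem .., fun i j => ?_⟩
  rw [spElt_eq]
  fin_cases i <;> fin_cases j <;> norm_num [wt]

lemma gMonge_m3 : gMonge (-3) = gEig (-3) := by
  apply le_antisymm
  · simp only [gMonge]
    norm_num
    refine Submodule.span_le.2 ?_
    rintro _ ⟨a11, a12, a22, rfl⟩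
    exact spElt_mem_m3 a11 a12 a22
  · intro X hX
    simp only [gMonge]
    norm_num
    refine Submodule.subset_span ⟨X 3 0, X 3 1, X 4 1, ?_⟩
    have h1 := gEig_entries hX
    norm_num at h1
    have h2 := eq_spElt_of_mem (mem_gEig.1 hX).1
    simpa only [h1, neg_zero] using h2

lemma finrank_m3 : Module.finrank ℝ (gMonge (-3)) = 3 := by
  let f : (Fin 3 → ℝ) →ₗ[ℝ] Matrix (Fin 6) (Fin 6) ℝ :=
    { toFun := fun x => spElt (x 0) (x 1) (x 2) 0 0 0 0 0 0 0 0 0 0 0 0 0 0 0 0 0 0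
      map_add' := by
        intro x y
        simp only [spElt_add, Pi.add_apply, add_zero]
      map_smul' := by
        intro r x
        simp only [spElt_smul, Pi.smul_apply, smul_eq_mul, mul_zero, RingHom.id_apply] }
  have hf : ∀ x, f x = spElt (x 0) (x 1) (x 2) 0 0 0 0 0 0 0 0 0 0 0 0 0 0 0 0 0 0 := fun _ => rfl
  have hinj : Function.Injective f := by
    intro x y h
    simp only [hf, spElt_eq] at h
    have h0 : x 0 = y 0 := congrFun (congrFun h 3) 0
    have h1 : x 1 = y 1 := congrFun (congrFun h 3) 1
    have h2 : x 2 = y 2 := congrFun (congrFun h 4) 1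
    ext i
    fin_cases i <;> assumption
  have hr : LinearMap.range f = gMonge (-3) := by
    rw [gMonge_m3]
    apply le_antisymm
    · rintro _ ⟨x, rfl⟩
      exact spElt_mem_m3 ..
    · intro X hX
      refine ⟨![X 3 0, X 3 1, X 4 1], ?_⟩
      have h1 := gEig_entries hX
      norm_num at h1
      have h2 := eq_spElt_of_mem (mem_gEig.1 hX).1
      simp only [h1, neg_zero] at h2
      exact h2.symm
  rw [← hr, LinearMap.finrank_range_of_inj hinj, Module.finrank_fin_fun]

lemma spElt_mem_m2 (u1 u2 : ℝ) :
    spElt 0 0 0 u1 u2 0 0 0 0 0 0 0 0 0 0 0 0 0 0 0 0 ∈ gEig (-2) := by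
  refine mem_gEig_entry.2 ⟨spElt_mem .., fun i j => ?_⟩
  rw [spElt_eq]
  fin_cases i <;> fin_cases j <;> norm_num [wt]

lemma gMonge_m2 : gMonge (-2) = gEig (-2) := by
  apply le_antisymm
  · simp only [gMonge]
    norm_num
    refine Submodule.span_le.2 ?_
    rintro _ ⟨u1, u2, rfl⟩
    exact spElt_mem_m2 u1 u2
  · intro X hX
    simp only [gMonge]
    norm_num
    refine Submodule.subset_span ⟨X 3 2, X 4 2, ?_⟩
    have h1 := gEig_entries hX
    norm_num at h1
    have h2 := eq_spElt_of_mem (mem_gEig.1 hX).1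
    simpa only [h1, neg_zero] using h2

lemma finrank_m2 : Module.finrank ℝ (gMonge (-2)) = 2 := by
  let f : (Fin 2 → ℝ) →ₗ[ℝ] Matrix (Fin 6) (Fin 6) ℝ :=
    { toFun := fun x => spElt 0 0 0 (x 0) (x 1) 0 0 0 0 0 0 0 0 0 0 0 0 0 0 0 0
      map_add' := by
        intro x y
        simp only [spElt_add, Pi.add_apply, add_zero]
      map_smul' := by
        intro r x
        simp only [spElt_smul, Pi.smul_apply, smul_eq_mul, mul_zero, RingHom.id_apply] }
  have hf : ∀ x, f x = spElt 0 0 0 (x 0) (x 1) 0 0 0 0 0 0 0 0 0 0 0 0 0 0 0 0 := fun _ => rfl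
  have hinj : Function.Injective f := by
    intro x y h
    simp only [hf, spElt_eq] at h
    have h0 : x 0 = y 0 := congrFun (congrFun h 3) 2
    have h1 : x 1 = y 1 := congrFun (congrFun h 4) 2
    ext i
    fin_cases i <;> assumption
  have hr : LinearMap.range f = gMonge (-2) := by
    rw [gMonge_m2]
    apply le_antisymm
    · rintro _ ⟨x, rfl⟩
      exact spElt_mem_m2 ..
    · intro X hX
      refine ⟨![X 3 2, X 4 2], ?_⟩
      have h1 := gEig_entries hX
      norm_num at h1
      have h2 := eq_spElt_of_mem (mem_gEig.1 hX).1
      simp only [h1, neg_zero] at h2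
      exact h2.symm
  rw [← hr, LinearMap.finrank_range_of_inj hinj, Module.finrank_fin_fun]

lemma spElt_mem_m1 (p1 p2 p : ℝ) :
    spElt 0 0 0 0 0 p1 p2 p 0 0 0 0 0 0 0 0 0 0 0 0 0 ∈ gEig (-1) := by
  refine mem_gEig_entry.2 ⟨spElt_mem .., fun i j => ?_⟩
  rw [spElt_eq]
  fin_cases i <;> fin_cases j <;> norm_num [wt]

lemma gMonge_m1 : gMonge (-1) = gEig (-1) := by
  apply le_antisymm
  · simp only [gMonge]
    norm_num
    refine Submodule.span_le.2 ?_
    rintro _ ⟨p1, p2, p, rfl⟩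
    exact spElt_mem_m1 p1 p2 p
  · intro X hX
    simp only [gMonge]
    norm_num
    refine Submodule.subset_span ⟨-X 2 0, -X 2 1, X 5 2, ?_⟩
    have h1 := gEig_entries hX
    norm_num at h1
    have h2 := eq_spElt_of_mem (mem_gEig.1 hX).1
    simpa only [h1, neg_zero] using h2

lemma finrank_m1 : Module.finrank ℝ (gMonge (-1)) = 3 := by
  let f : (Fin 3 → ℝ) →ₗ[ℝ] Matrix (Fin 6) (Fin 6) ℝ :=
    { toFun := fun x => spElt 0 0 0 0 0 (x 0) (x 1) (x 2) 0 0 0 0 0 0 0 0 0 0 0 0 0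
      map_add' := by
        intro x y
        simp only [spElt_add, Pi.add_apply, add_zero]
      map_smul' := by
        intro r x
        simp only [spElt_smul, Pi.smul_apply, smul_eq_mul, mul_zero, RingHom.id_apply] }
  have hf : ∀ x, f x = spElt 0 0 0 0 0 (x 0) (x 1) (x 2) 0 0 0 0 0 0 0 0 0 0 0 0 0 := fun _ => rfl
  have hinj : Function.Injective f := by
    intro x y h
    simp only [hf, spElt_eq] at h
    have h0 : x 0 = y 0 := congrFun (congrFun h 3) 5
    have h1 : x 1 = y 1 := congrFun (congrFun h 4) 5
    have h2 : x 2 = y 2 := congrFun (congrFun h 5) 2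
    ext i
    fin_cases i <;> assumption
  have hr : LinearMap.range f = gMonge (-1) := by
    rw [gMonge_m1]
    apply le_antisymm
    · rintro _ ⟨x, rfl⟩
      exact spElt_mem_m1 ..
    · intro X hX
      refine ⟨![-X 2 0, -X 2 1, X 5 2], ?_⟩
      have h1 := gEig_entries hX
      norm_num at h1
      have h2 := eq_spElt_of_mem (mem_gEig.1 hX).1
      simp only [h1, neg_zero] at h2
      exact h2.symm
  rw [← hr, LinearMap.finrank_range_of_inj hinj, Module.finrank_fin_fun]

lemma spElt_mem_z0 (c11 c12 c21 c22 c : ℝ) :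
    spElt 0 0 0 0 0 0 0 0 c11 c12 c21 c22 c 0 0 0 0 0 0 0 0 ∈ gEig (0) := by
  refine mem_gEig_entry.2 ⟨spElt_mem .., fun i j => ?_⟩
  rw [spElt_eq]
  fin_cases i <;> fin_cases j <;> norm_num [wt]

lemma gMonge_z0 : gMonge (0) = gEig (0) := by
  apply le_antisymm
  · simp only [gMonge]
    norm_num
    refine Submodule.span_le.2 ?_
    rintro _ ⟨c11, c12, c21, c22, c, rfl⟩
    exact spElt_mem_z0 c11 c12 c21 c22 c
  · intro X hX
    simp only [gMonge]
    norm_num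
    refine Submodule.subset_span ⟨X 0 0, X 0 1, X 1 0, X 1 1, X 2 2, ?_⟩
    have h1 := gEig_entries hX
    norm_num at h1
    have h2 := eq_spElt_of_mem (mem_gEig.1 hX).1
    simpa only [h1, neg_zero] using h2

lemma finrank_z0 : Module.finrank ℝ (gMonge (0)) = 5 := by
  let f : (Fin 5 → ℝ) →ₗ[ℝ] Matrix (Fin 6) (Fin 6) ℝ :=
    { toFun := fun x => spElt 0 0 0 0 0 0 0 0 (x 0) (x 1) (x 2) (x 3) (x 4) 0 0 0 0 0 0 0 0
      map_add' := by
        intro x y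
        simp only [spElt_add, Pi.add_apply, add_zero]
      map_smul' := by
        intro r x
        simp only [spElt_smul, Pi.smul_apply, smul_eq_mul, mul_zero, RingHom.id_apply] }
  have hf : ∀ x, f x = spElt 0 0 0 0 0 0 0 0 (x 0) (x 1) (x 2) (x 3) (x 4) 0 0 0 0 0 0 0 0 := fun _ => rfl
  have hinj : Function.Injective f := by
    intro x y h
    simp only [hf, spElt_eq] at h
    have h0 : x 0 = y 0 := congrFun (congrFun h 0) 0
    have h1 : x 1 = y 1 := congrFun (congrFun h 0) 1
    have h2 : x 2 = y 2 := congrFun (congrFun h 1) 0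
    have h3 : x 3 = y 3 := congrFun (congrFun h 1) 1
    have h4 : x 4 = y 4 := congrFun (congrFun h 2) 2
    ext i
    fin_cases i <;> assumption
  have hr : LinearMap.range f = gMonge (0) := by
    rw [gMonge_z0]
    apply le_antisymm
    · rintro _ ⟨x, rfl⟩
      exact spElt_mem_z0 ..
    · intro X hX
      refine ⟨![X 0 0, X 0 1, X 1 0, X 1 1, X 2 2], ?_⟩
      have h1 := gEig_entries hX
      norm_num at h1
      have h2 := eq_spElt_of_mem (mem_gEig.1 hX).1
      simp only [h1, neg_zero] at h2
      exact h2.symm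
  rw [← hr, LinearMap.finrank_range_of_inj hinj, Module.finrank_fin_fun]

lemma spElt_mem_p1 (q1 q2 q : ℝ) :
    spElt 0 0 0 0 0 0 0 0 0 0 0 0 0 q1 q2 q 0 0 0 0 0 ∈ gEig (1) := by
  refine mem_gEig_entry.2 ⟨spElt_mem .., fun i j => ?_⟩
  rw [spElt_eq]
  fin_cases i <;> fin_cases j <;> norm_num [wt]

lemma gMonge_p1 : gMonge (1) = gEig (1) := by
  apply le_antisymm
  · simp only [gMonge]
    norm_num
    refine Submodule.span_le.2 ?_
    rintro _ ⟨q1, q2, q, rfl⟩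
    exact spElt_mem_p1 q1 q2 q
  · intro X hX
    simp only [gMonge]
    norm_num
    refine Submodule.subset_span ⟨X 0 2, X 1 2, X 2 5, ?_⟩
    have h1 := gEig_entries hX
    norm_num at h1
    have h2 := eq_spElt_of_mem (mem_gEig.1 hX).1
    simpa only [h1, neg_zero] using h2

lemma finrank_p1 : Module.finrank ℝ (gMonge (1)) = 3 := by
  let f : (Fin 3 → ℝ) →ₗ[ℝ] Matrix (Fin 6) (Fin 6) ℝ :=
    { toFun := fun x => spElt 0 0 0 0 0 0 0 0 0 0 0 0 0 (x 0) (x 1) (x 2) 0 0 0 0 0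
      map_add' := by
        intro x y
        simp only [spElt_add, Pi.add_apply, add_zero]
      map_smul' := by
        intro r x
        simp only [spElt_smul, Pi.smul_apply, smul_eq_mul, mul_zero, RingHom.id_apply] }
  have hf : ∀ x, f x = spElt 0 0 0 0 0 0 0 0 0 0 0 0 0 (x 0) (x 1) (x 2) 0 0 0 0 0 := fun _ => rfl
  have hinj : Function.Injective f := by
    intro x y h
    simp only [hf, spElt_eq] at h
    have h0 : x 0 = y 0 := congrFun (congrFun h 0) 2
    have h1 : x 1 = y 1 := congrFun (congrFun h 1) 2
    have h2 : x 2 = y 2 := congrFun (congrFun h 2) 5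
    ext i
    fin_cases i <;> assumption
  have hr : LinearMap.range f = gMonge (1) := by
    rw [gMonge_p1]
    apply le_antisymm
    · rintro _ ⟨x, rfl⟩
      exact spElt_mem_p1 ..
    · intro X hX
      refine ⟨![X 0 2, X 1 2, X 2 5], ?_⟩
      have h1 := gEig_entries hX
      norm_num at h1
      have h2 := eq_spElt_of_mem (mem_gEig.1 hX).1
      simp only [h1, neg_zero] at h2
      exact h2.symm
  rw [← hr, LinearMap.finrank_range_of_inj hinj, Module.finrank_fin_fun]

lemma spElt_mem_p2 (v1 v2 : ℝ) :
    spElt 0 0 0 0 0 0 0 0 0 0 0 0 0 0 0 0 v1 v2 0 0 0 ∈ gEig (2) := by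
  refine mem_gEig_entry.2 ⟨spElt_mem .., fun i j => ?_⟩
  rw [spElt_eq]
  fin_cases i <;> fin_cases j <;> norm_num [wt]

lemma gMonge_p2 : gMonge (2) = gEig (2) := by
  apply le_antisymm
  · simp only [gMonge]
    norm_num
    refine Submodule.span_le.2 ?_
    rintro _ ⟨v1, v2, rfl⟩
    exact spElt_mem_p2 v1 v2
  · intro X hX
    simp only [gMonge]
    norm_num
    refine Submodule.subset_span ⟨X 0 5, X 1 5, ?_⟩
    have h1 := gEig_entries hX
    norm_num at h1
    have h2 := eq_spElt_of_mem (mem_gEig.1 hX).1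
    simpa only [h1, neg_zero] using h2

lemma finrank_p2 : Module.finrank ℝ (gMonge (2)) = 2 := by
  let f : (Fin 2 → ℝ) →ₗ[ℝ] Matrix (Fin 6) (Fin 6) ℝ :=
    { toFun := fun x => spElt 0 0 0 0 0 0 0 0 0 0 0 0 0 0 0 0 (x 0) (x 1) 0 0 0
      map_add' := by
        intro x y
        simp only [spElt_add, Pi.add_apply, add_zero]
      map_smul' := by
        intro r x
        simp only [spElt_smul, Pi.smul_apply, smul_eq_mul, mul_zero, RingHom.id_apply] }
  have hf : ∀ x, f x = spElt 0 0 0 0 0 0 0 0 0 0 0 0 0 0 0 0 (x 0) (x 1) 0 0 0 := fun _ => rfl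
  have hinj : Function.Injective f := by
    intro x y h
    simp only [hf, spElt_eq] at h
    have h0 : x 0 = y 0 := congrFun (congrFun h 0) 5
    have h1 : x 1 = y 1 := congrFun (congrFun h 1) 5
    ext i
    fin_cases i <;> assumption
  have hr : LinearMap.range f = gMonge (2) := by
    rw [gMonge_p2]
    apply le_antisymm
    · rintro _ ⟨x, rfl⟩
      exact spElt_mem_p2 ..
    · intro X hX
      refine ⟨![X 0 5, X 1 5], ?_⟩
      have h1 := gEig_entries hX
      norm_num at h1
      have h2 := eq_spElt_of_mem (mem_gEig.1 hX).1
      simp only [h1, neg_zero] at h2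
      exact h2.symm
  rw [← hr, LinearMap.finrank_range_of_inj hinj, Module.finrank_fin_fun]

lemma spElt_mem_p3 (b11 b12 b22 : ℝ) :
    spElt 0 0 0 0 0 0 0 0 0 0 0 0 0 0 0 0 0 0 b11 b12 b22 ∈ gEig (3) := by
  refine mem_gEig_entry.2 ⟨spElt_mem .., fun i j => ?_⟩
  rw [spElt_eq]
  fin_cases i <;> fin_cases j <;> norm_num [wt]

lemma gMonge_p3 : gMonge (3) = gEig (3) := by
  apply le_antisymm
  · simp only [gMonge]
    norm_num
    refine Submodule.span_le.2 ?_
    rintro _ ⟨b11, b12, b22, rfl⟩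
    exact spElt_mem_p3 b11 b12 b22
  · intro X hX
    simp only [gMonge]
    norm_num
    refine Submodule.subset_span ⟨X 0 3, X 0 4, X 1 4, ?_⟩
    have h1 := gEig_entries hX
    norm_num at h1
    have h2 := eq_spElt_of_mem (mem_gEig.1 hX).1
    simpa only [h1, neg_zero] using h2

lemma finrank_p3 : Module.finrank ℝ (gMonge (3)) = 3 := by
  let f : (Fin 3 → ℝ) →ₗ[ℝ] Matrix (Fin 6) (Fin 6) ℝ :=
    { toFun := fun x => spElt 0 0 0 0 0 0 0 0 0 0 0 0 0 0 0 0 0 0 (x 0) (x 1) (x 2)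
      map_add' := by
        intro x y
        simp only [spElt_add, Pi.add_apply, add_zero]
      map_smul' := by
        intro r x
        simp only [spElt_smul, Pi.smul_apply, smul_eq_mul, mul_zero, RingHom.id_apply] }
  have hf : ∀ x, f x = spElt 0 0 0 0 0 0 0 0 0 0 0 0 0 0 0 0 0 0 (x 0) (x 1) (x 2) := fun _ => rfl
  have hinj : Function.Injective f := by
    intro x y h
    simp only [hf, spElt_eq] at h
    have h0 : x 0 = y 0 := congrFun (congrFun h 0) 3
    have h1 : x 1 = y 1 := congrFun (congrFun h 0) 4
    have h2 : x 2 = y 2 := congrFun (congrFun h 1) 4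
    ext i
    fin_cases i <;> assumption
  have hr : LinearMap.range f = gMonge (3) := by
    rw [gMonge_p3]
    apply le_antisymm
    · rintro _ ⟨x, rfl⟩
      exact spElt_mem_p3 ..
    · intro X hX
      refine ⟨![X 0 3, X 0 4, X 1 4], ?_⟩
      have h1 := gEig_entries hX
      norm_num at h1
      have h2 := eq_spElt_of_mem (mem_gEig.1 hX).1
      simp only [h1, neg_zero] at h2
      exact h2.symm
  rw [← hr, LinearMap.finrank_range_of_inj hinj, Module.finrank_fin_fun]

lemma gMonge_big (k : ℤ) (hk : 3 < |k|) : gMonge k = ⊥ := by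
  have h : ∀ d : ℤ, |d| ≤ 3 → k ≠ d := by
    rintro d hd rfl
    omega
  simp only [gMonge]
  rw [if_neg (h _ (by norm_num)), if_neg (h _ (by norm_num)), if_neg (h _ (by norm_num)),
    if_neg (h _ (by norm_num)), if_neg (h _ (by norm_num)), if_neg (h _ (by norm_num)),
    if_neg (h _ (by norm_num))]

lemma gEig_big (k : ℤ) (hk : 3 < |k|) : gEig k = ⊥ := by
  have h : ∀ d : ℤ, |d| ≤ 3 → k ≠ d := by
    rintro d hd rfl
    omega
  rw [eq_bot_iff]
  intro X hX
  obtain ⟨h1, h2, h3, h4, h5, h6, h7⟩ := gEig_entries hX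
  replace h1 := h1 (h _ (by norm_num))
  replace h2 := h2 (h _ (by norm_num))
  replace h3 := h3 (h _ (by norm_num))
  replace h4 := h4 (h _ (by norm_num))
  replace h5 := h5 (h _ (by norm_num))
  replace h6 := h6 (h _ (by norm_num))
  replace h7 := h7 (h _ (by norm_num))
  have h8 := eq_spElt_of_mem (mem_gEig.1 hX).1
  simp only [h1, h2, h3, h4, h5, h6, h7, neg_zero] at h8
  rw [Submodule.mem_bot, h8, spElt_eq]
  ext i j
  fin_cases i <;> fin_cases j <;> simp

lemma gMonge_eq : gMonge = gEig := by
  funext k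
  by_cases hk : 3 < |k|
  · rw [gMonge_big k hk, gEig_big k hk]
  · have h := abs_le.1 (not_lt.1 hk)
    obtain ⟨h1, h2⟩ := h
    interval_cases k
    · exact gMonge_m3
    · exact gMonge_m2
    · exact gMonge_m1
    · exact gMonge_z0
    · exact gMonge_p1
    · exact gMonge_p2
    · exact gMonge_p3

lemma iSup_gEig : (⨆ k : ℤ, gEig k) = sp3 := by
  apply le_antisymm
  · exact iSup_le fun k => inf_le_left
  · intro X hX
    have key : X = spElt (X 3 0) (X 3 1) (X 4 1) 0 0 0 0 0 0 0 0 0 0 0 0 0 0 0 0 0 0 +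
      spElt 0 0 0 (X 3 2) (X 4 2) 0 0 0 0 0 0 0 0 0 0 0 0 0 0 0 0 +
      spElt 0 0 0 0 0 (-X 2 0) (-X 2 1) (X 5 2) 0 0 0 0 0 0 0 0 0 0 0 0 0 +
      spElt 0 0 0 0 0 0 0 0 (X 0 0) (X 0 1) (X 1 0) (X 1 1) (X 2 2) 0 0 0 0 0 0 0 0 +
      spElt 0 0 0 0 0 0 0 0 0 0 0 0 0 (X 0 2) (X 1 2) (X 2 5) 0 0 0 0 0 +
      spElt 0 0 0 0 0 0 0 0 0 0 0 0 0 0 0 0 (X 0 5) (X 1 5) 0 0 0 +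
      spElt 0 0 0 0 0 0 0 0 0 0 0 0 0 0 0 0 0 0 (X 0 3) (X 0 4) (X 1 4) := by
      conv_lhs => rw [eq_spElt_of_mem hX]
      simp only [spElt_eq]
      ext i j
      fin_cases i <;> fin_cases j <;> simp
    rw [key]
    have le : ∀ k, gEig k ≤ ⨆ k : ℤ, gEig k := le_iSup gEig
    refine add_mem (add_mem (add_mem (add_mem (add_mem (add_mem ?_ ?_) ?_) ?_) ?_) ?_) ?_
    · exact le _ (spElt_mem_m3 ..)
    · exact le _ (spElt_mem_m2 ..)
    · exact le _ (spElt_mem_m1 ..)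
    · exact le _ (spElt_mem_z0 ..)
    · exact le _ (spElt_mem_p1 ..)
    · exact le _ (spElt_mem_p2 ..)
    · exact le _ (spElt_mem_p3 ..)

lemma indep_gEig : iSupIndep gEig := by
  have h := (Module.End.eigenspaces_iSupIndep adE).comp
    (f := fun k : ℤ => 2 * (k : ℝ)) (fun a b hab => by simpa using hab)
  exact h.mono fun k => inf_le_right

lemma bracket_gEig (i j : ℤ) (X Y : Matrix (Fin 6) (Fin 6) ℝ) (hX : X ∈ gEig i)
    (hY : Y ∈ gEig j) : X * Y - Y * X ∈ gEig (i + j) := by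
  rw [mem_gEig] at *
  obtain ⟨hX, eX⟩ := hX
  obtain ⟨hY, eY⟩ := hY
  constructor
  · rw [mem_sp3] at *
    rw [Matrix.transpose_sub, Matrix.transpose_mul, Matrix.transpose_mul]
    have : (Yᵀ * Xᵀ - Xᵀ * Yᵀ) * J6 + J6 * (X * Y - Y * X) =
        Yᵀ * (Xᵀ * J6 + J6 * X) - Xᵀ * (Yᵀ * J6 + J6 * Y)
        - (Yᵀ * J6 + J6 * Y) * X + (Xᵀ * J6 + J6 * X) * Y := by
      noncomm_ring
    rw [this, hX, hY]
    simp
  · have : gradE * (X * Y - Y * X) - (X * Y - Y * X) * gradE =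
        (gradE * X - X * gradE) * Y - Y * (gradE * X - X * gradE)
        + X * (gradE * Y - Y * gradE) - (gradE * Y - Y * gradE) * X := by
      noncomm_ring
    rw [this, eX, eY]
    simp only [smul_mul_assoc, mul_smul_comm]
    push_cast
    module

/-- The Monge gradation of `sp(3,ℝ)`: `sp(3,ℝ)` is the internal direct sum
`g₋₃ ⊕ g₋₂ ⊕ g₋₁ ⊕ g₀ ⊕ g₁ ⊕ g₂ ⊕ g₃`, the dimensions are `3,2,3,5,3,2,3`, and the
matrix commutator satisfies `[gᵢ, gⱼ] ⊆ g_{i+j}` (with `g_k = {0}` for `|k| > 3`). -/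
theorem monge_gradation_sp3 :
    (⨆ k : ℤ, gMonge k) = sp3 ∧
    iSupIndep gMonge ∧
    Module.finrank ℝ (gMonge (-3)) = 3 ∧
    Module.finrank ℝ (gMonge (-2)) = 2 ∧
    Module.finrank ℝ (gMonge (-1)) = 3 ∧
    Module.finrank ℝ (gMonge 0) = 5 ∧
    Module.finrank ℝ (gMonge 1) = 3 ∧
    Module.finrank ℝ (gMonge 2) = 2 ∧
    Module.finrank ℝ (gMonge 3) = 3 ∧
    (∀ k : ℤ, 3 < |k| → gMonge k = ⊥) ∧
    (∀ (i j : ℤ) (X Y : Matrix (Fin 6) (Fin 6) ℝ),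
      X ∈ gMonge i → Y ∈ gMonge j → X * Y - Y * X ∈ gMonge (i + j)) := by
  refine ⟨?_, ?_, finrank_m3, finrank_m2, finrank_m1, finrank_z0, finrank_p1, finrank_p2,
    finrank_p3, gMonge_big, ?_⟩
  · rw [gMonge_eq]; exact iSup_gEig
  · rw [gMonge_eq]; exact indep_gEig
  · rw [gMonge_eq]; exact bracket_gEig
end
end

section
/- With the Monge gradation g₋₃, g₋₂, g₋₁ of sp(3,ℝ) (as 6×6 matrices), the subspace m = g₋₃ ⊕ g₋₂ ⊕ g₋₁ is a Lie subalgebra of sp(3,ℝ) (closed under matrix commutator) which is nilpotent of step exactly 3: [m,[m,m]] ≠ {0} and [m,[m,[m,m]]] = {0}; moreover [m,m] = g₋₂ ⊕ g₋₃ and [m,[m,m]] = g₋₃. -/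
open Matrix

noncomputable section

/-- `g₋₃`: only the symmetric 2×2 block `a` of `C` may be nonzero. -/
def gm3 : Submodule ℝ (Matrix (Fin 6) (Fin 6) ℝ) :=
  Submodule.span ℝ {X | ∃ a11 a12 a22 : ℝ,
    X = spElt a11 a12 a22 0 0 0 0 0 0 0 0 0 0 0 0 0 0 0 0 0 0}

/-- `g₋₂`: only the vector `u` may be nonzero. -/
def gm2 : Submodule ℝ (Matrix (Fin 6) (Fin 6) ℝ) :=
  Submodule.span ℝ {X | ∃ u1 u2 : ℝ,
    X = spElt 0 0 0 u1 u2 0 0 0 0 0 0 0 0 0 0 0 0 0 0 0 0}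

/-- `g₋₁`: only the vector `p` and the scalar `p` may be nonzero. -/
def gm1 : Submodule ℝ (Matrix (Fin 6) (Fin 6) ℝ) :=
  Submodule.span ℝ {X | ∃ p1 p2 p : ℝ,
    X = spElt 0 0 0 0 0 p1 p2 p 0 0 0 0 0 0 0 0 0 0 0 0 0}

/-- `m = g₋₃ ⊕ g₋₂ ⊕ g₋₁`, the nilpotent negative part of the Monge gradation. -/
def mMonge : Submodule ℝ (Matrix (Fin 6) (Fin 6) ℝ) := gm3 ⊔ gm2 ⊔ gm1

/-- The span of all commutators `[X,Y] = XY − YX` with `X ∈ M`, `Y ∈ N`. -/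
def bracketSpan (M N : Submodule ℝ (Matrix (Fin 6) (Fin 6) ℝ)) :
    Submodule ℝ (Matrix (Fin 6) (Fin 6) ℝ) :=
  Submodule.span ℝ {Z | ∃ X ∈ M, ∃ Y ∈ N, Z = X * Y - Y * X}

/-- A general element of `m`. -/
def mElt (a b c u v p q s : ℝ) : Matrix (Fin 6) (Fin 6) ℝ :=
  spElt a b c u v p q s 0 0 0 0 0 0 0 0 0 0 0 0 0

lemma blk6_eq (A B C D : Matrix (Fin 3) (Fin 3) ℝ) : blk6 A B C D =
    !![A 0 0, A 0 1, A 0 2, B 0 0, B 0 1, B 0 2;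
       A 1 0, A 1 1, A 1 2, B 1 0, B 1 1, B 1 2;
       A 2 0, A 2 1, A 2 2, B 2 0, B 2 1, B 2 2;
       C 0 0, C 0 1, C 0 2, D 0 0, D 0 1, D 0 2;
       C 1 0, C 1 1, C 1 2, D 1 0, D 1 1, D 1 2;
       C 2 0, C 2 1, C 2 2, D 2 0, D 2 1, D 2 2] := by
  ext i j
  fin_cases i <;> fin_cases j <;> rfl

lemma mElt_eq (a b c u v p q s : ℝ) : mElt a b c u v p q s =
    !![0, 0, 0, 0, 0, 0;
       0, 0, 0, 0, 0, 0;
       -p, -q, 0, 0, 0, 0;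
       a, b, u, 0, 0, p;
       b, c, v, 0, 0, q;
       u, v, s, 0, 0, 0] := by
  simp only [mElt, spElt, blk6_eq]
  ext i j
  fin_cases i <;> fin_cases j <;> simp

lemma mElt_add (a b c u v p q s a' b' c' u' v' p' q' s' : ℝ) :
    mElt a b c u v p q s + mElt a' b' c' u' v' p' q' s' =
      mElt (a + a') (b + b') (c + c') (u + u') (v + v') (p + p') (q + q') (s + s') := by
  simp only [mElt_eq]
  ext i j
  fin_cases i <;> fin_cases j <;> simp [add_comm]

lemma mElt_smul (r a b c u v p q s : ℝ) :
    r • mElt a b c u v p q s =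
      mElt (r * a) (r * b) (r * c) (r * u) (r * v) (r * p) (r * q) (r * s) := by
  simp only [mElt_eq]
  ext i j
  fin_cases i <;> fin_cases j <;> simp

lemma mElt_zero : mElt 0 0 0 0 0 0 0 0 = 0 := by
  simp only [mElt_eq]
  ext i j
  fin_cases i <;> fin_cases j <;> simp

lemma mElt_bracket (a b c u v p q s a' b' c' u' v' p' q' s' : ℝ) :
    mElt a b c u v p q s * mElt a' b' c' u' v' p' q' s' -
      mElt a' b' c' u' v' p' q' s' * mElt a b c u v p q s =
      mElt (2 * (p * u' - p' * u)) (p * v' + q * u' - p' * v - q' * u) (2 * (q * v' - q' * v))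
        (p * s' - p' * s) (q * s' - q' * s) 0 0 0 := by
  simp only [mElt_eq]
  ext i j
  fin_cases i <;> fin_cases j <;> simp [Matrix.mul_apply, Fin.sum_univ_succ] <;> ring

lemma mElt_sp (a b c u v p q s : ℝ) : mElt a b c u v p q s ∈ sp3 := by
  change _ = _
  simp only [mElt_eq, J6_eq]
  ext i j
  fin_cases i <;> fin_cases j <;> simp [Matrix.mul_apply, Fin.sum_univ_succ]

lemma mem_gm3 (X : Matrix (Fin 6) (Fin 6) ℝ) :
    X ∈ gm3 ↔ ∃ a b c, X = mElt a b c 0 0 0 0 0 := by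
  constructor
  · intro h
    induction h using Submodule.span_induction with
    | mem x h => exact h
    | zero => exact ⟨0, 0, 0, mElt_zero.symm⟩
    | add x y _ _ hx hy =>
      obtain ⟨a, b, c, rfl⟩ := hx
      obtain ⟨a', b', c', rfl⟩ := hy
      exact ⟨a + a', b + b', c + c', by simp [mElt_add]⟩
    | smul r x _ hx =>
      obtain ⟨a, b, c, rfl⟩ := hx
      exact ⟨r * a, r * b, r * c, by simp [mElt_smul]⟩
  · intro h
    exact Submodule.subset_span h

lemma mem_gm2 (X : Matrix (Fin 6) (Fin 6) ℝ) :
    X ∈ gm2 ↔ ∃ u v, X = mElt 0 0 0 u v 0 0 0 := by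
  constructor
  · intro h
    induction h using Submodule.span_induction with
    | mem x h => exact h
    | zero => exact ⟨0, 0, mElt_zero.symm⟩
    | add x y _ _ hx hy =>
      obtain ⟨a, b, rfl⟩ := hx
      obtain ⟨a', b', rfl⟩ := hy
      exact ⟨a + a', b + b', by simp [mElt_add]⟩
    | smul r x _ hx =>
      obtain ⟨a, b, rfl⟩ := hx
      exact ⟨r * a, r * b, by simp [mElt_smul]⟩
  · intro h
    exact Submodule.subset_span h

lemma mem_gm1 (X : Matrix (Fin 6) (Fin 6) ℝ) :
    X ∈ gm1 ↔ ∃ p q s, X = mElt 0 0 0 0 0 p q s := by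
  constructor
  · intro h
    induction h using Submodule.span_induction with
    | mem x h => exact h
    | zero => exact ⟨0, 0, 0, mElt_zero.symm⟩
    | add x y _ _ hx hy =>
      obtain ⟨a, b, c, rfl⟩ := hx
      obtain ⟨a', b', c', rfl⟩ := hy
      exact ⟨a + a', b + b', c + c', by simp [mElt_add]⟩
    | smul r x _ hx =>
      obtain ⟨a, b, c, rfl⟩ := hx
      exact ⟨r * a, r * b, r * c, by simp [mElt_smul]⟩
  · intro h
    exact Submodule.subset_span h

lemma mem_gm23 (X : Matrix (Fin 6) (Fin 6) ℝ) :
    X ∈ gm2 ⊔ gm3 ↔ ∃ a b c u v, X = mElt a b c u v 0 0 0 := by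
  simp only [Submodule.mem_sup, mem_gm2, mem_gm3]
  constructor
  · rintro ⟨_, ⟨u, v, rfl⟩, _, ⟨a, b, c, rfl⟩, rfl⟩
    exact ⟨a, b, c, u, v, by simp [mElt_add]⟩
  · rintro ⟨a, b, c, u, v, rfl⟩
    exact ⟨_, ⟨u, v, rfl⟩, _, ⟨a, b, c, rfl⟩, by simp [mElt_add]⟩

lemma mem_mMonge (X : Matrix (Fin 6) (Fin 6) ℝ) :
    X ∈ mMonge ↔ ∃ a b c u v p q s, X = mElt a b c u v p q s := by
  rw [mMonge, sup_comm gm3 gm2]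
  simp only [Submodule.mem_sup (p := gm2 ⊔ gm3), mem_gm23, mem_gm1]
  constructor
  · rintro ⟨_, ⟨a, b, c, u, v, rfl⟩, _, ⟨p, q, s, rfl⟩, rfl⟩
    exact ⟨a, b, c, u, v, p, q, s, by simp [mElt_add]⟩
  · rintro ⟨a, b, c, u, v, p, q, s, rfl⟩
    exact ⟨_, ⟨a, b, c, u, v, rfl⟩, _, ⟨p, q, s, rfl⟩, by simp [mElt_add]⟩

lemma bracket_mem {M N : Submodule ℝ (Matrix (Fin 6) (Fin 6) ℝ)}
    {X Y : Matrix (Fin 6) (Fin 6) ℝ} (hX : X ∈ M) (hY : Y ∈ N) :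
    X * Y - Y * X ∈ bracketSpan M N :=
  Submodule.subset_span ⟨X, hX, Y, hY, rfl⟩

lemma gm3_le : gm3 ≤ bracketSpan mMonge (gm2 ⊔ gm3) := by
  intro X hX
  obtain ⟨a, b, c, rfl⟩ := (mem_gm3 X).1 hX
  have h1 := bracket_mem ((mem_mMonge _).2 ⟨0, 0, 0, 0, 0, 1, 0, 0, rfl⟩)
    ((mem_gm23 _).2 ⟨0, 0, 0, a / 2, b, rfl⟩)
  have h2 := bracket_mem ((mem_mMonge _).2 ⟨0, 0, 0, 0, 0, 0, 1, 0, rfl⟩)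
    ((mem_gm23 _).2 ⟨0, 0, 0, 0, c / 2, rfl⟩)
  have h := Submodule.add_mem _ h1 h2
  rw [mElt_bracket, mElt_bracket, mElt_add] at h
  convert h using 2 <;> ring

lemma bracket_m_m : bracketSpan mMonge mMonge = gm2 ⊔ gm3 := by
  apply le_antisymm
  · refine Submodule.span_le.2 ?_
    rintro _ ⟨X, hX, Y, hY, rfl⟩
    obtain ⟨a, b, c, u, v, p, q, s, rfl⟩ := (mem_mMonge X).1 hX
    obtain ⟨a', b', c', u', v', p', q', s', rfl⟩ := (mem_mMonge Y).1 hY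
    rw [mElt_bracket]
    exact (mem_gm23 _).2 ⟨_, _, _, _, _, rfl⟩
  · refine sup_le ?_ (gm3_le.trans (Submodule.span_mono ?_))
    · intro X hX
      obtain ⟨u, v, rfl⟩ := (mem_gm2 X).1 hX
      have h := bracket_mem ((mem_mMonge _).2 ⟨0, 0, 0, 0, 0, u, v, 0, rfl⟩)
        ((mem_mMonge _).2 ⟨0, 0, 0, 0, 0, 0, 0, 1, rfl⟩)
      rw [mElt_bracket] at h
      convert h using 2 <;> ring
    · rintro _ ⟨X, hX, Y, hY, rfl⟩
      obtain ⟨a, b, c, u, v, rfl⟩ := (mem_gm23 Y).1 hY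
      exact ⟨X, hX, _, (mem_mMonge _).2 ⟨_, _, _, _, _, _, _, _, rfl⟩, rfl⟩

lemma bracket_m_23 : bracketSpan mMonge (gm2 ⊔ gm3) = gm3 := by
  refine le_antisymm (Submodule.span_le.2 ?_) gm3_le
  rintro _ ⟨X, hX, Y, hY, rfl⟩
  obtain ⟨a, b, c, u, v, p, q, s, rfl⟩ := (mem_mMonge X).1 hX
  obtain ⟨a', b', c', u', v', rfl⟩ := (mem_gm23 Y).1 hY
  rw [mElt_bracket]
  refine (mem_gm3 _).2 ⟨2 * (p * u'), p * v' + q * u', 2 * (q * v'), ?_⟩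
  congr 1 <;> ring

lemma bracket_m_3 : bracketSpan mMonge gm3 = ⊥ := by
  refine le_antisymm (Submodule.span_le.2 ?_) bot_le
  rintro _ ⟨X, hX, Y, hY, rfl⟩
  obtain ⟨a, b, c, u, v, p, q, s, rfl⟩ := (mem_mMonge X).1 hX
  obtain ⟨a', b', c', rfl⟩ := (mem_gm3 Y).1 hY
  rw [mElt_bracket]
  simp [mElt_zero]

lemma gm3_ne : gm3 ≠ ⊥ := by
  intro h
  have h1 : mElt 1 0 0 0 0 0 0 0 ∈ gm3 := (mem_gm3 _).2 ⟨1, 0, 0, rfl⟩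
  rw [h, Submodule.mem_bot, mElt_eq] at h1
  have h2 := congrFun (congrFun h1 3) 0
  simp at h2

/-- `m = g₋₃ ⊕ g₋₂ ⊕ g₋₁` is a Lie subalgebra of `sp(3,ℝ)`, nilpotent of step exactly 3:
`[m,m] = g₋₂ ⊕ g₋₃`, `[m,[m,m]] = g₋₃ ≠ 0`, and `[m,[m,[m,m]]] = 0`. -/
theorem mMonge_nilpotent_step_three :
    mMonge ≤ sp3 ∧
    (∀ X ∈ mMonge, ∀ Y ∈ mMonge, X * Y - Y * X ∈ mMonge) ∧
    bracketSpan mMonge mMonge = gm2 ⊔ gm3 ∧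
    bracketSpan mMonge (bracketSpan mMonge mMonge) = gm3 ∧
    bracketSpan mMonge (bracketSpan mMonge (bracketSpan mMonge mMonge)) = ⊥ ∧
    bracketSpan mMonge (bracketSpan mMonge mMonge) ≠ ⊥ := by
  refine ⟨?_, ?_, bracket_m_m, ?_, ?_, ?_⟩
  · intro X hX
    obtain ⟨a, b, c, u, v, p, q, s, rfl⟩ := (mem_mMonge X).1 hX
    exact mElt_sp _ _ _ _ _ _ _ _
  · intro X hX Y hY
    obtain ⟨a, b, c, u, v, p, q, s, rfl⟩ := (mem_mMonge X).1 hX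
    obtain ⟨a', b', c', u', v', p', q', s', rfl⟩ := (mem_mMonge Y).1 hY
    rw [mElt_bracket]
    exact (mem_mMonge _).2 ⟨_, _, _, _, _, _, _, _, rfl⟩
  · rw [bracket_m_m, bracket_m_23]
  · rw [bracket_m_m, bracket_m_23, bracket_m_3]
  · rw [bracket_m_m, bracket_m_23]
    exact gm3_ne
end
end

section
/- Let U ⊆ ℝ⁸ be open and connected, let ω¹,…,ω⁸ be continuous 1-forms on U that are pointwise linearly independent, and let u, v₁, v₂, w₁, w₂, w₃, z₁, z₂, z₃, z₄ : U → ℝ be differentiable functions with u nowhere zero, satisfying at every point: Du = v₁ω² + v₂ω⁷; Dv₁ = w₁ω² + w₂ω⁷; Dv₂ = w₂ω² + 2v₁ω⁵ + w₃ω⁷; Dw₁ = z₁ω² + z₂ω⁷; Dw₃ = z₃ω² + 4w₂ω⁵ + z₄ω⁷ + 2v₁ω⁸. If moreover 5v₂² = 4u·w₃ identically on U (i.e. the invariant I₁ = 5v₂² − 4uw₃ vanishes), then v₁ ≡ 0, w₁ ≡ 0, w₂ ≡ 0, z₁ ≡ 0, z₂ ≡ 0, z₃ ≡ 0, and 8u²z₄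 = 15v₂³ on U. -/
noncomputable section

/- Index convention for the coframe: ω¹,…,ω⁸ ↦ ω 0,…,ω 7. -/

/-- Uniqueness of derivatives for a function vanishing on an open set. -/
theorem deriv_zero_of_zero_on {U : Set (Fin 8 → ℝ)} (hU : IsOpen U)
    {f : (Fin 8 → ℝ) → ℝ} (hf : ∀ x ∈ U, f x = 0) {x : Fin 8 → ℝ} (hx : x ∈ U)
    {L : (Fin 8 → ℝ) →L[ℝ] ℝ} (hL : HasFDerivAt f L x) : L = 0 := by
  have h0 : HasFDerivAt f (0 : (Fin 8 → ℝ) →L[ℝ] ℝ) x :=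
    (hasFDerivAt_const (0 : ℝ) x).congr_of_eventuallyEq
      (Filter.eventuallyEq_of_mem (hU.mem_nhds hx) hf)
  exact hL.unique h0

/-- Coefficient extraction for the four covectors that occur. -/
theorem coeff_zero {e : Fin 8 → ((Fin 8 → ℝ) →L[ℝ] ℝ)} (he : LinearIndependent ℝ e)
    {a b c d : ℝ} (h : a • e 1 + b • e 4 + c • e 6 + d • e 7 = 0) :
    a = 0 ∧ b = 0 ∧ c = 0 ∧ d = 0 := by
  have key := Fintype.linearIndependent_iff.1 he ![0, a, 0, 0, b, 0, c, d]
    (by rw [← h]; simp [Fin.sum_univ_succ, add_assoc])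
  exact ⟨key 1, key 4, key 6, key 7⟩

/-- On a connected open set `U ⊆ ℝ⁸` carrying a continuous pointwise-independent coframe
`ω¹,…,ω⁸` and differentiable functions `u,v₁,v₂,w₁,w₂,w₃,z₁,z₂,z₃,z₄` with `u ≠ 0`
satisfying the structural equations (4.2)–(4.3), the vanishing of the invariant
`I₁ = 5v₂² − 4uw₃` forces `v₁ = w₁ = w₂ = z₁ = z₂ = z₃ = 0` and `8u²z₄ = 15v₂³`. -/
theorem I1_zero_consequences
    (U : Set (Fin 8 → ℝ)) (hUopen : IsOpen U) (hUconn : IsConnected U)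
    (ω : Fin 8 → (Fin 8 → ℝ) → ((Fin 8 → ℝ) →L[ℝ] ℝ))
    (hωcont : ∀ i, ContinuousOn (ω i) U)
    (hωind : ∀ x ∈ U, LinearIndependent ℝ fun i : Fin 8 => ω i x)
    (u v1 v2 w1 w2 w3 z1 z2 z3 z4 : (Fin 8 → ℝ) → ℝ)
    (hu : ∀ x ∈ U, u x ≠ 0)
    (hw2diff : DifferentiableOn ℝ w2 U)
    (hz1diff : DifferentiableOn ℝ z1 U)
    (hz2diff : DifferentiableOn ℝ z2 U)
    (hz3diff : DifferentiableOn ℝ z3 U)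
    (hz4diff : DifferentiableOn ℝ z4 U)
    -- Du = v₁ω² + v₂ω⁷
    (hdu : ∀ x ∈ U, HasFDerivAt u (v1 x • ω 1 x + v2 x • ω 6 x) x)
    -- Dv₁ = w₁ω² + w₂ω⁷
    (hdv1 : ∀ x ∈ U, HasFDerivAt v1 (w1 x • ω 1 x + w2 x • ω 6 x) x)
    -- Dv₂ = w₂ω² + 2v₁ω⁵ + w₃ω⁷
    (hdv2 : ∀ x ∈ U, HasFDerivAt v2
      (w2 x • ω 1 x + (2 * v1 x) • ω 4 x + w3 x • ω 6 x) x)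
    -- Dw₁ = z₁ω² + z₂ω⁷
    (hdw1 : ∀ x ∈ U, HasFDerivAt w1 (z1 x • ω 1 x + z2 x • ω 6 x) x)
    -- Dw₃ = z₃ω² + 4w₂ω⁵ + z₄ω⁷ + 2v₁ω⁸
    (hdw3 : ∀ x ∈ U, HasFDerivAt w3
      (z3 x • ω 1 x + (4 * w2 x) • ω 4 x + z4 x • ω 6 x + (2 * v1 x) • ω 7 x) x)
    -- I₁ = 5v₂² − 4uw₃ ≡ 0
    (hI1 : ∀ x ∈ U, 5 * (v2 x) ^ 2 = 4 * u x * w3 x) :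
    ∀ x ∈ U, v1 x = 0 ∧ w1 x = 0 ∧ w2 x = 0 ∧ z1 x = 0 ∧ z2 x = 0 ∧ z3 x = 0 ∧
      8 * (u x) ^ 2 * z4 x = 15 * (v2 x) ^ 3 := by
  have hI : ∀ x ∈ U, v1 x = 0 ∧ (10 * v2 x * w2 x = 4 * w3 x * v1 x + 4 * u x * z3 x) ∧
      (10 * v2 x * w3 x = 4 * w3 x * v2 x + 4 * u x * z4 x) := by
    intro x hx
    have hd := ((((hdv2 x hx).mul (hdv2 x hx)).const_mul 5).sub
      (((hdu x hx).mul (hdw3 x hx)).const_mul 4))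
    have h0 := deriv_zero_of_zero_on hUopen
      (fun y hy => by
        have := hI1 y hy
        simp only [Pi.sub_apply, Pi.mul_apply]
        linarith) hx hd
    obtain ⟨ha, -, hc, hd'⟩ := coeff_zero (hωind x hx)
      (a := 10 * v2 x * w2 x - 4 * w3 x * v1 x - 4 * u x * z3 x)
      (b := 20 * v2 x * v1 x - 16 * u x * w2 x)
      (c := 10 * v2 x * w3 x - 4 * w3 x * v2 x - 4 * u x * z4 x)
      (d := -(8 * u x * v1 x))
      (by rw [← h0]; module)
    have hux := hu x hx
    refine ⟨?_, by linarith, by linarith⟩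
    have : u x * v1 x = 0 := by linarith
    exact (mul_eq_zero.1 this).resolve_left hux
  have hw : ∀ x ∈ U, w1 x = 0 ∧ w2 x = 0 := by
    intro x hx
    have h0 := deriv_zero_of_zero_on hUopen (fun y hy => (hI y hy).1) hx (hdv1 x hx)
    obtain ⟨ha, -, hc, -⟩ := coeff_zero (hωind x hx) (a := w1 x) (b := 0) (c := w2 x) (d := 0)
      (by rw [← h0]; module)
    exact ⟨ha, hc⟩
  intro x hx
  have h0 := deriv_zero_of_zero_on hUopen (fun y hy => (hw y hy).1) hx (hdw1 x hx)
  obtain ⟨hz1, -, hz2, -⟩ := coeff_zero (hωind x hx) (a := z1 x) (b := 0) (c := z2 x) (d := 0)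
    (by rw [← h0]; module)
  obtain ⟨hv, e1, e2⟩ := hI x hx
  obtain ⟨hw1, hw2⟩ := hw x hx
  refine ⟨hv, hw1, hw2, hz1, hz2, ?_, ?_⟩
  · rw [hw2, hv] at e1
    have : u x * z3 x = 0 := by linarith
    exact (mul_eq_zero.1 this).resolve_left (hu x hx)
  · linear_combination (-2 * u x) * e2 - 3 * v2 x * hI1 x hx
end
end

section
/- For s ∈ ℝ let h : (0,∞) → ℝ, h(t) = t^s (real power). Then for all t > 0: 5·h⁗(t)² − 4·h‴(t)·h⁽⁵⁾(t) = s²(s−1)²(s−2)²(s+1)(s−3)·t^{2s−8}. Consequently the quantity I₁ = ¼(5h⁗² − 4h‴h⁽⁵⁾) is nonvanishing on (0,∞) if and only if s ∉ {−1, 0, 1, 2, 3}. -/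
noncomputable section

/-- The `k`-th derivative of `h(t) = t^s` (real power). -/
def hd (s : ℝ) (k : ℕ) : ℝ → ℝ := deriv^[k] (fun x : ℝ => x ^ s)

/-- For `h(t) = t^s` and `t > 0`, `5h⁗(t)² − 4h‴(t)h⁽⁵⁾(t)
= s²(s−1)²(s−2)²(s+1)(s−3)·t^{2s−8}`; consequently the invariant
`I₁ = ¼(5h⁗² − 4h‴h⁽⁵⁾)` is nonvanishing on `(0,∞)` iff `s ∉ {−1,0,1,2,3}`. -/
theorem I1_power_law (s : ℝ) :
    (∀ t : ℝ, 0 < t →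
      5 * (hd s 4 t) ^ 2 - 4 * hd s 3 t * hd s 5 t
        = s ^ 2 * (s - 1) ^ 2 * (s - 2) ^ 2 * (s + 1) * (s - 3) * t ^ (2 * s - 8)) ∧
    ((∀ t : ℝ, 0 < t →
        (1/4 : ℝ) * (5 * (hd s 4 t) ^ 2 - 4 * hd s 3 t * hd s 5 t) ≠ 0)
      ↔ s ∉ ({-1, 0, 1, 2, 3} : Set ℝ)) := by
  have key : ∀ t : ℝ, 0 < t →
      5 * (hd s 4 t) ^ 2 - 4 * hd s 3 t * hd s 5 t
        = s ^ 2 * (s - 1) ^ 2 * (s - 2) ^ 2 * (s + 1) * (s - 3) * t ^ (2 * s - 8) := by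
    intro t ht
    have h3 : hd s 3 t = s * (s - 1) * (s - 2) * t ^ (s - 3) := by
      simp [hd, Real.iter_deriv_rpow_const, descPochhammer_eval_eq_prod_range,
        Finset.prod_range_succ]
    have h4 : hd s 4 t = s * (s - 1) * (s - 2) * (s - 3) * t ^ (s - 4) := by
      simp [hd, Real.iter_deriv_rpow_const, descPochhammer_eval_eq_prod_range,
        Finset.prod_range_succ]
    have h5 : hd s 5 t = s * (s - 1) * (s - 2) * (s - 3) * (s - 4) * t ^ (s - 5) := by
      simp [hd, Real.iter_deriv_rpow_const, descPochhammer_eval_eq_prod_range,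
        Finset.prod_range_succ]
    have e1 : t ^ (s - 4) * t ^ (s - 4) = t ^ (2 * s - 8) := by
      rw [← Real.rpow_add ht]; congr 1; ring
    have e2 : t ^ (s - 3) * t ^ (s - 5) = t ^ (2 * s - 8) := by
      rw [← Real.rpow_add ht]; congr 1; ring
    rw [h3, h4, h5]
    linear_combination (5 * (s * (s - 1) * (s - 2) * (s - 3)) ^ 2) * e1
      - 4 * (s * (s - 1) * (s - 2)) ^ 2 * (s - 3) * (s - 4) * e2
  refine ⟨key, ?_⟩
  constructor
  · intro h hs
    apply h 1 one_pos
    rw [key 1 one_pos]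
    simp only [Set.mem_insert_iff, Set.mem_singleton_iff] at hs
    rcases hs with rfl | rfl | rfl | rfl | rfl <;> norm_num
  · intro hs t ht
    simp only [Set.mem_insert_iff, Set.mem_singleton_iff, not_or] at hs
    obtain ⟨a, b, c, d, e⟩ := hs
    rw [key t ht]
    have a' : s + 1 ≠ 0 := fun h => a (by linarith)
    have c' := sub_ne_zero.mpr c
    have d' := sub_ne_zero.mpr d
    have e' := sub_ne_zero.mpr e
    have := (Real.rpow_pos_of_pos ht (2 * s - 8)).ne'
    positivity
end
end

section
/- For every s ∈ ℝ and every t > 0, with h(t) = t^s (real power), the identity (15·h⁗(t)³ − 18·h‴(t)·h⁗(t)·h⁽⁵⁾(t) + 4·h‴(t)²·h⁽⁶⁾(t))² · (s+1)(s−3) = (s−1)² · (5·h⁗(t)² − 4·h‴(t)·h⁽⁵⁾(t))³ holds. In particular, for s ∉ {−1,0,1,2,3} the square of the invariant S₄ = (15h⁗³ − 18h‴h⁗h⁽⁵⁾ + 4h‴²h⁽⁶⁾)/√(ε(5h⁗² − 4h‴h⁽⁵⁾)³), where ε = sign((s+1)(s−3)), is the constant (s−1)²/((s+1)(s−3))·ε⁻¹·ε²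 = (s−1)²/(ε(s+1)(s−3)), independent of t. -/
noncomputable section

/-- Closed form of the derivatives of a power function on the positive half line. -/
theorem hd_closed (s : ℝ) (k : ℕ) : ∀ t : ℝ, 0 < t →
    hd s k t = (∏ i ∈ Finset.range k, (s - i)) * t ^ (s - k) := by
  induction k with
  | zero => intro t ht; simp [hd]
  | succ k ih =>
    intro t ht
    have h1 : hd s (k + 1) t = deriv (hd s k) t := by
      simp only [hd, Function.iterate_succ_apply']
    have h2 : hd s k =ᶠ[nhds t]
        fun x => (∏ i ∈ Finset.range k, (s - i)) * x ^ (s - k) := by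
      filter_upwards [lt_mem_nhds ht] with x hx using ih x hx
    rw [h1, h2.deriv_eq,
      ((Real.hasDerivAt_rpow_const (p := s - k) (Or.inl ht.ne')).const_mul _).deriv,
      Finset.prod_range_succ]
    push_cast
    rw [show s - ((k : ℝ) + 1) = s - k - 1 by ring]
    ring

/-- The derivatives of orders three to six, in terms of `u = t ^ (s - 6)`. -/
theorem hd_values (s t : ℝ) (ht : 0 < t) : ∃ u : ℝ, 0 < u ∧
    hd s 3 t = s * (s - 1) * (s - 2) * (u * t ^ 3) ∧
    hd s 4 t = s * (s - 1) * (s - 2) * (s - 3) * (u * t ^ 2) ∧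
    hd s 5 t = s * (s - 1) * (s - 2) * (s - 3) * (s - 4) * (u * t) ∧
    hd s 6 t = s * (s - 1) * (s - 2) * (s - 3) * (s - 4) * (s - 5) * u := by
  have e3 : t ^ (s - 3) = t ^ (s - 6) * t ^ 3 := by
    rw [← Real.rpow_natCast t 3, ← Real.rpow_add ht]; congr 1; push_cast; ring
  have e4 : t ^ (s - 4) = t ^ (s - 6) * t ^ 2 := by
    rw [← Real.rpow_natCast t 2, ← Real.rpow_add ht]; congr 1; push_cast; ring
  have e5 : t ^ (s - 5) = t ^ (s - 6) * t := by
    rw [← Real.rpow_add_one ht.ne']; congr 1; ring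
  refine ⟨t ^ (s - 6), Real.rpow_pos_of_pos ht _, ?_, ?_, ?_, ?_⟩
  · rw [hd_closed s 3 t ht, ← e3]; simp [Finset.prod_range_succ]
  · rw [hd_closed s 4 t ht, ← e4]; simp [Finset.prod_range_succ]
  · rw [hd_closed s 5 t ht, ← e5]; simp [Finset.prod_range_succ]
  · rw [hd_closed s 6 t ht]; simp [Finset.prod_range_succ]

/-- For `h(t) = t^s`, `t > 0`, the identity
`(15h⁗³ − 18h‴h⁗h⁽⁵⁾ + 4h‴²h⁽⁶⁾)²(s+1)(s−3) = (s−1)²(5h⁗² − 4h‴h⁽⁵⁾)³` holds; in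
particular, for `s ∉ {−1,0,1,2,3}` the square of
`S₄ = (15h⁗³ − 18h‴h⁗h⁽⁵⁾ + 4h‴²h⁽⁶⁾)/√(ε(5h⁗² − 4h‴h⁽⁵⁾)³)`, `ε = sign((s+1)(s−3))`,
is the constant `(s−1)²/(ε(s+1)(s−3))`, independent of `t`. -/
theorem S4_power_law (s : ℝ) :
    (∀ t : ℝ, 0 < t →
      (15 * (hd s 4 t) ^ 3 - 18 * hd s 3 t * hd s 4 t * hd s 5 t
          + 4 * (hd s 3 t) ^ 2 * hd s 6 t) ^ 2 * ((s + 1) * (s - 3))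
        = (s - 1) ^ 2 * (5 * (hd s 4 t) ^ 2 - 4 * hd s 3 t * hd s 5 t) ^ 3) ∧
    (s ∉ ({-1, 0, 1, 2, 3} : Set ℝ) → ∀ t : ℝ, 0 < t →
      ((15 * (hd s 4 t) ^ 3 - 18 * hd s 3 t * hd s 4 t * hd s 5 t
          + 4 * (hd s 3 t) ^ 2 * hd s 6 t)
        / Real.sqrt (Real.sign ((s + 1) * (s - 3))
            * (5 * (hd s 4 t) ^ 2 - 4 * hd s 3 t * hd s 5 t) ^ 3)) ^ 2
      = (s - 1) ^ 2 / (Real.sign ((s + 1) * (s - 3)) * (s + 1) * (s - 3))) := by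
  have key : ∀ t : ℝ, 0 < t →
      (15 * (hd s 4 t) ^ 3 - 18 * hd s 3 t * hd s 4 t * hd s 5 t
          + 4 * (hd s 3 t) ^ 2 * hd s 6 t) ^ 2 * ((s + 1) * (s - 3))
        = (s - 1) ^ 2 * (5 * (hd s 4 t) ^ 2 - 4 * hd s 3 t * hd s 5 t) ^ 3 := by
    intro t ht
    obtain ⟨u, -, h3, h4, h5, h6⟩ := hd_values s t ht
    rw [h3, h4, h5, h6]
    ring
  refine ⟨key, ?_⟩
  intro hs t ht
  have hk := key t ht
  simp only [Set.mem_insert_iff, Set.mem_singleton_iff, not_or] at hs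
  obtain ⟨hm1, h0, h1, h2, h3⟩ := hs
  have hq : (s + 1) * (s - 3) ≠ 0 :=
    mul_ne_zero (fun h => hm1 (by linarith)) (sub_ne_zero.mpr h3)
  have hD : ∃ c : ℝ, 0 < c ∧
      5 * (hd s 4 t) ^ 2 - 4 * hd s 3 t * hd s 5 t = c * ((s + 1) * (s - 3)) := by
    obtain ⟨u, hu, g3, g4, g5, -⟩ := hd_values s t ht
    refine ⟨(s * (s - 1) * (s - 2) * (u * t ^ 2)) ^ 2, ?_, ?_⟩
    · have : s * (s - 1) * (s - 2) * (u * t ^ 2) ≠ 0 :=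
        mul_ne_zero (mul_ne_zero (mul_ne_zero h0 (sub_ne_zero.mpr h1)) (sub_ne_zero.mpr h2))
          (by positivity)
      positivity
    · rw [g3, g4, g5]; ring
  obtain ⟨c, hc, hDc⟩ := hD
  generalize 15 * (hd s 4 t) ^ 3 - 18 * hd s 3 t * hd s 4 t * hd s 5 t
          + 4 * (hd s 3 t) ^ 2 * hd s 6 t = N at *
  generalize 5 * (hd s 4 t) ^ 2 - 4 * hd s 3 t * hd s 5 t = D at *
  subst hDc
  rw [mul_assoc (Real.sign _)]
  generalize (s + 1) * (s - 3) = q at *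
  have hpos : 0 < Real.sign q * (c * q) ^ 3 := by
    rcases lt_or_gt_of_ne hq with h | h
    · rw [Real.sign_of_neg h]
      have : 0 < (c * -q) ^ 3 := pow_pos (mul_pos hc (neg_pos.mpr h)) 3
      linarith [show (c * -q) ^ 3 = -1 * (c * q) ^ 3 by ring]
    · rw [Real.sign_of_pos h]; positivity
  have hsg : Real.sign q ≠ 0 := fun h => by simp [h] at hpos
  rw [div_pow, Real.sq_sqrt hpos.le, div_eq_div_iff hpos.ne' (mul_ne_zero hsg hq)]
  linear_combination Real.sign q * hk
end
end
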